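/- Let D = ℂ ∖ {0,1} and let f = (f₁, f₂) : D × D → D × D be a proper holomorphic map. Then there exist holomorphic maps g₁, g₂ : D → D such that either f(z₁, z₂) = (g₁(z₁), g₂(z₂)) for all (z₁, z₂) ∈ D × D, or f(z₁, z₂) = (g₁(z₂), g₂(z₁)) for all (z₁, z₂) ∈ D × D. -/

import Mathlib

open Set

section Helpers

open Metric Filter Topology

lemma log_ball {f : ℂ → ℂ} {c : ℂ} {r : ℝ} (hr : 0 < r) (hf : DifferentiableOn ℂ f (ball c r))
    (h0 : ∀ z ∈ ball c r, f z ≠ 0) (l : ℂ) (hl : Complex.exp l = f c) :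
    ∃ L : ℂ → ℂ, DifferentiableOn ℂ L (ball c r) ∧ L c = l ∧ ∀ z ∈ ball c r, Complex.exp (L z) = f z := by
  have hd : DifferentiableOn ℂ (fun z => deriv f z / f z) (ball c r) :=
    (hf.deriv isOpen_ball).div hf h0
  obtain ⟨L, hL⟩ := hd.isExactOn_ball.with_val_at c l
  have hLd : ∀ z ∈ ball c r, HasDerivAt L (deriv f z / f z) z := fun z hz => hL.2 z hz
  have hLD : DifferentiableOn ℂ L (ball c r) :=
    fun z hz => (hLd z hz).differentiableAt.differentiableWithinAt
  refine ⟨L, hLD, hL.1, fun z hz => ?_⟩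
  have key : (fun z => Complex.exp (- L z) * f z) z = (fun z => Complex.exp (- L z) * f z) c := by
    apply isOpen_ball.is_const_of_deriv_eq_zero (convex_ball c r).isPreconnected (𝕜 := ℂ)
      (s := ball c r) ?_ ?_ hz (mem_ball_self hr)
    · exact (hLD.neg.cexp).mul hf
    · intro w hw
      have h1 := ((hLd w hw).neg.cexp).mul (hf.differentiableAt (isOpen_ball.mem_nhds hw)).hasDerivAt
      have h2 := h1.deriv
      have h3 := h0 w hw
      simp only [Pi.zero_apply]
      refine Eq.trans h2 ?_
      simp only [Pi.neg_apply]
      field_simp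
      ring
  simp only [hL.1, ← hl, ← Complex.exp_add, neg_add_cancel, Complex.exp_zero] at key
  rw [Complex.exp_neg] at key
  have := Complex.exp_ne_zero (L z)
  field_simp at key
  exact key.symm

lemma bloch {f : ℂ → ℂ} {c : ℂ} {r R : ℝ} (hr : 0 < r) (hrR : r < R)
    (hf : DifferentiableOn ℂ f (ball c R)) :
    ∃ w, ball w (r * ‖deriv f c‖ / 48) ⊆ f '' ball c R := by
  have hsub : closedBall c r ⊆ ball c R := closedBall_subset_ball hrR
  have hd := hf.deriv isOpen_ball
  have hcont : ContinuousOn (fun z => ‖deriv f z‖ * (r - dist z c)) (closedBall c r) := by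
    refine ContinuousOn.mul (hd.continuousOn.mono hsub).norm ?_
    fun_prop
  obtain ⟨a, ha, hmax⟩ := (isCompact_closedBall c r).exists_isMaxOn
    ⟨c, mem_closedBall_self hr.le⟩ hcont
  rw [isMaxOn_iff] at hmax
  have h0 := hmax c (mem_closedBall_self hr.le)
  simp only [dist_self, sub_zero] at h0
  by_cases hz : ‖deriv f c‖ = 0
  · exact ⟨0, by simp [hz]⟩
  have hpos : 0 < ‖deriv f c‖ := lt_of_le_of_ne (norm_nonneg _) (Ne.symm hz)
  rw [mem_closedBall] at ha
  set M := ‖deriv f a‖ with hM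
  obtain ⟨t, ht⟩ : ∃ t, t = (r - dist a c) / 2 := ⟨_, rfl⟩
  have hprod : 0 < M * (r - dist a c) := lt_of_lt_of_le (by positivity) h0
  have hMnn : 0 ≤ M := norm_nonneg _
  have hMpos : 0 < M := by
    rcases hMnn.eq_or_lt with h | h
    · rw [← h] at hprod; simp at hprod
    · exact h
  have htpos : 0 < t := by
    have := (pos_iff_pos_of_mul_pos hprod).1 hMpos
    linarith
  have hball : ∀ z ∈ ball a t, z ∈ closedBall c r ∧ t ≤ r - dist z c := by
    intro z hz
    rw [mem_ball] at hz
    have := dist_triangle z a c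
    rw [mem_closedBall]
    constructor <;> linarith
  have hsub2 : ball a t ⊆ ball c R := fun z hz => hsub (hball z hz).1
  have hb : ∀ z ∈ ball a t, ‖deriv f z‖ ≤ 2 * M := by
    intro z hz
    obtain ⟨h1, h2⟩ := hball z hz
    have h3 := hmax z h1
    have h4 : ‖deriv f z‖ * t ≤ ‖deriv f z‖ * (r - dist z c) := by gcongr
    have h5 : ‖deriv f z‖ * t ≤ (2 * M) * t := by
      calc _ ≤ _ := h4
        _ ≤ _ := h3
        _ = _ := by rw [ht]; ring
    exact le_of_mul_le_mul_right h5 htpos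
  have hmaps : MapsTo (deriv f) (ball a t) (closedBall (deriv f a) (3 * M)) := by
    intro z hz
    rw [mem_closedBall, dist_eq_norm]
    have := norm_sub_le (deriv f z) (deriv f a)
    have := hb z hz
    linarith
  have hS : ∀ z ∈ closedBall a (t / 6), ‖deriv f z - deriv f a‖ ≤ M / 2 := by
    intro z hz
    rw [mem_closedBall] at hz
    have h1 := Complex.dist_le_div_mul_dist_of_mapsTo_ball (hd.mono hsub2) hmaps
      (z := z) (by rw [mem_ball]; linarith)
    rw [dist_eq_norm] at h1
    calc _ ≤ _ := h1
      _ ≤ 3 * M / t * (t / 6) := by gcongr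
      _ = _ := by field_simp; norm_num
  have hsub3 : closedBall a (t / 6) ⊆ ball a t := closedBall_subset_ball (by linarith)
  have hlow : ∀ z ∈ sphere a (t / 6), M * t / 12 ≤ ‖f z - f a‖ := by
    intro z hz
    have h1 := (convex_closedBall a (t/6)).norm_image_sub_le_of_norm_hasDerivWithin_le
      (f := fun z => f z - deriv f a * z) (f' := fun z => deriv f z - deriv f a)
      (C := M / 2) (x := a) (y := z) ?_ hS (mem_closedBall_self (by linarith))
      (sphere_subset_closedBall hz)
    · rw [mem_sphere, dist_eq_norm] at hz
      rw [hz] at h1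
      have h2 : ‖deriv f a * (z - a)‖ ≤ ‖f z - f a‖ + ‖f z - deriv f a * z - (f a - deriv f a * a)‖ := by
        have := norm_sub_le (f z - f a) (f z - deriv f a * z - (f a - deriv f a * a))
        refine le_trans (le_of_eq ?_) this
        congr 1
        ring
      rw [norm_mul, hz, ← hM] at h2
      nlinarith
    · intro x hx
      have := (hf.differentiableAt (isOpen_ball.mem_nhds (hsub2 (hsub3 hx)))).hasDerivAt
      exact (this.sub (by simpa using (hasDerivAt_id x).const_mul (deriv f a))).hasDerivWithinAt
  have hfr : ∃ᶠ z in 𝓝 a, f z ≠ f a := by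
    have := (hf.differentiableAt (isOpen_ball.mem_nhds (hsub2 (mem_ball_self htpos)))).hasDerivAt
    have h1 := this.eventually_ne (c := f a) (by rw [← norm_pos_iff]; exact hMpos)
    exact h1.frequently.filter_mono nhdsWithin_le_nhds
  have hDC : DiffContOnCl ℂ f (ball a (t/6)) := by
    refine DifferentiableOn.diffContOnCl ?_
    exact hf.mono ((closure_ball_subset_closedBall).trans (hsub3.trans hsub2))
  refine ⟨f a, ?_⟩
  have h1 := hDC.ball_subset_image_closedBall (by linarith) hlow hfr
  refine (ball_subset_ball ?_).trans (h1.trans (image_mono (hsub3.trans hsub2)))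
  have : M * (r - dist a c) = 2 * (M * t) := by rw [ht]; ring
  linarith

lemma net_real (x : ℝ) (hx : 0 ≤ x) : ∃ (s : ℝ) (n : ℕ), |s - x| ≤ 1 ∧ Real.sinh s ^ 2 = n := by
  refine ⟨Real.arsinh (√(⌊Real.sinh x ^ 2⌋₊ : ℝ)), ⌊Real.sinh x ^ 2⌋₊, ?_, ?_⟩
  swap
  · rw [Real.sinh_arsinh, Real.sq_sqrt (by positivity)]
  set n := ⌊Real.sinh x ^ 2⌋₊ with hn
  set s := Real.arsinh (√(n : ℝ)) with hs
  have hss : Real.sinh s = √(n : ℝ) := Real.sinh_arsinh _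
  have hs2 : Real.sinh s ^ 2 = n := by rw [hss, Real.sq_sqrt (by positivity)]
  have hs0 : 0 ≤ Real.sinh s := by rw [hss]; positivity
  have hx0 : 0 ≤ Real.sinh x := Real.sinh_nonneg_iff.2 hx
  have h1 : (n : ℝ) ≤ Real.sinh x ^ 2 := Nat.floor_le (by positivity)
  have h2 : Real.sinh x ^ 2 < n + 1 := Nat.lt_floor_add_one _
  have h3 : s ≤ x := by
    rw [← Real.sinh_le_sinh]
    nlinarith
  have h4 : x ≤ s + 1 := by
    rw [← Real.sinh_le_sinh, Real.sinh_add]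
    have a1 : 1 ≤ Real.cosh 1 := Real.one_le_cosh 1
    have a2 : 1 ≤ Real.cosh s := Real.one_le_cosh s
    have a3 : 1 ≤ Real.sinh 1 := Real.self_le_sinh_iff.2 zero_le_one
    have : Real.sinh s + 1 ≤ Real.sinh s * Real.cosh 1 + Real.cosh s * Real.sinh 1 := by nlinarith
    nlinarith
  rw [abs_le]
  constructor <;> linarith

lemma net_real' (x : ℝ) : ∃ (s : ℝ) (n : ℕ), |s - x| ≤ 1 ∧ Real.sinh s ^ 2 = n := by
  rcases le_total 0 x with h | h
  · exact net_real x h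
  · obtain ⟨s, n, h1, h2⟩ := net_real (-x) (by linarith)
    refine ⟨-s, n, ?_, by rw [Real.sinh_neg, neg_sq, h2]⟩
    rw [← abs_neg]; convert h1 using 2; ring

lemma net (w : ℂ) : ∃ (p : ℂ) (n : ℤ), p ∈ ball w 4 ∧ Complex.cosh p ^ 2 = n := by
  obtain ⟨s, n, h1, h2⟩ := net_real' w.re
  refine ⟨⟨s, round (w.im / Real.pi) * Real.pi⟩, n + 1, ?_, ?_⟩
  · rw [mem_ball, dist_eq_norm]
    refine lt_of_le_of_lt (Complex.norm_le_abs_re_add_abs_im _) ?_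
    simp only [Complex.sub_re, Complex.sub_im]
    have h3 := abs_sub_round (w.im / Real.pi)
    have h4 : |(round (w.im / Real.pi)) * Real.pi - w.im| ≤ 2 := by
      have : (round (w.im / Real.pi)) * Real.pi - w.im =
        - ((w.im / Real.pi - round (w.im / Real.pi)) * Real.pi) := by
        field_simp; ring
      rw [this, abs_neg, abs_mul, abs_of_pos Real.pi_pos]
      have := Real.pi_lt_four
      have := Real.pi_pos
      nlinarith
    linarith
  · have e : (⟨s, round (w.im / Real.pi) * Real.pi⟩ : ℂ) =
      (s : ℂ) + (round (w.im / Real.pi) : ℤ) * (Real.pi * Complex.I) := by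
      apply Complex.ext <;> simp
    rw [e]
    have per : ∀ m : ℤ, Complex.sinh (m * (Real.pi * Complex.I)) = 0 := by
      intro m
      have := Complex.sin_int_mul_pi m
      rw [← mul_assoc, Complex.sinh_mul_I, this, zero_mul]
    have hc := Complex.cosh_sq (((round (w.im / Real.pi) : ℤ) : ℂ) * (Real.pi * Complex.I))
    rw [per] at hc
    rw [Complex.cosh_add, per, mul_zero, add_zero, mul_pow, hc, Complex.cosh_sq, ← Complex.ofReal_sinh,
      ← Complex.ofReal_pow, h2]
    push_cast
    ring

lemma landau {h : ℂ → ℂ} {R : ℝ} (hR : 0 < R) (hd : DifferentiableOn ℂ h (ball 0 R))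
    (hn : ∀ z ∈ ball (0:ℂ) R, ∀ n : ℤ, Complex.cosh (h z) ^ 2 ≠ n) :
    ∀ z ∈ closedBall (0:ℂ) (R / 2), ‖h z - h 0‖ ≤ 384 := by
  have hb : ∀ z ∈ closedBall (0:ℂ) (R / 2), ‖deriv h z‖ ≤ 768 / R := by
    intro z hz
    rw [mem_closedBall] at hz
    have hsub : ball z (R / 2) ⊆ ball 0 R := ball_subset_ball' (by linarith)
    obtain ⟨w, hw⟩ := bloch (c := z) (r := R / 4) (R := R / 2) (by linarith) (by linarith)
      (hd.mono hsub)
    obtain ⟨p, n, hp, hpn⟩ := net w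
    by_contra hcon
    push Not at hcon
    have h4 : 4 ≤ R / 4 * ‖deriv h z‖ / 48 := by
      rw [div_lt_iff₀ hR] at hcon
      linarith
    obtain ⟨y, hy, rfl⟩ := hw (ball_subset_ball h4 hp)
    exact hn y (hsub hy) n hpn
  intro z hz
  have hsub : closedBall (0:ℂ) (R / 2) ⊆ ball 0 R := closedBall_subset_ball (by linarith)
  have := (convex_closedBall (0:ℂ) (R/2)).norm_image_sub_le_of_norm_deriv_le
    (fun x hx => hd.differentiableAt (isOpen_ball.mem_nhds (hsub hx))) hb
    (mem_closedBall_self (by linarith)) hz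
  refine this.trans ?_
  rw [mem_closedBall, dist_eq_norm] at hz
  calc 768 / R * ‖z - 0‖ ≤ 768 / R * (R / 2) := by gcongr
    _ = 384 := by field_simp; norm_num

lemma schottky : ∃ C : ℝ, ∀ (R : ℝ) (g : ℂ → ℂ), 0 < R → DifferentiableOn ℂ g (ball 0 R) →
    (∀ z ∈ ball (0:ℂ) R, g z ≠ 0 ∧ g z ≠ 1) → 1 / 2 ≤ ‖g 0‖ → ‖g 0‖ ≤ 2 →
    ∀ z ∈ closedBall (0:ℂ) (R / 2), ‖g z‖ ≤ C := by
  refine ⟨Real.exp (2 * Real.pi * Real.exp 386 ^ 2), fun R g hR hg hom hl hu z hz => ?_⟩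
  have h00 : (0:ℂ) ∈ ball (0:ℂ) R := mem_ball_self hR
  obtain ⟨L, hL, hL0, hLe⟩ := log_ball hR hg (fun z hz => (hom z hz).1) (Complex.log (g 0))
    (Complex.exp_log (hom 0 h00).1)
  obtain ⟨F, hF⟩ : ∃ F : ℂ → ℂ, F = fun z => L z / (2 * Real.pi * Complex.I) := ⟨_, rfl⟩
  have hpi : (2 * Real.pi * Complex.I : ℂ) ≠ 0 := by simp [Real.pi_ne_zero]
  have hFL : ∀ z, L z = F z * (2 * Real.pi * Complex.I) := by
    intro z; rw [hF]; field_simp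
  have hFd : DifferentiableOn ℂ F (ball 0 R) := by
    rw [hF]; exact hL.div_const _
  have hFn : ∀ z ∈ ball (0:ℂ) R, ∀ n : ℤ, F z ≠ n := by
    intro z hz n hn
    apply (hom z hz).2
    rw [← hLe z hz, hFL, hn, Complex.exp_int_mul_two_pi_mul_I]
  have hF0 : ‖F 0‖ ≤ 2 := by
    rw [hF]
    simp only [norm_div, hL0]
    have h1 : ‖Complex.log (g 0)‖ ≤ 1 + Real.pi := by
      refine (Complex.norm_le_abs_re_add_abs_im _).trans ?_
      rw [Complex.log_re, Complex.log_im]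
      refine add_le_add ?_ (Complex.abs_arg_le_pi _)
      have hgp : 0 < ‖g 0‖ := by linarith
      rw [abs_le]
      constructor
      · have := Real.one_sub_inv_le_log_of_pos hgp
        have h3 : ‖g 0‖⁻¹ ≤ 2 := by
          rw [inv_le_comm₀ hgp (by norm_num)]; linarith
        linarith
      · have := Real.log_le_sub_one_of_pos hgp
        linarith
    have h2 : ‖(2 * Real.pi * Complex.I : ℂ)‖ = 2 * Real.pi := by
      simp [abs_of_pos Real.pi_pos]
    rw [h2, div_le_iff₀ (by positivity)]
    have := Real.pi_gt_three
    linarith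
  have sqrt_ex : ∀ G : ℂ → ℂ, DifferentiableOn ℂ G (ball 0 R) → (∀ z ∈ ball (0:ℂ) R, G z ≠ 0) →
      ∃ u : ℂ → ℂ, DifferentiableOn ℂ u (ball 0 R) ∧ ∀ z ∈ ball (0:ℂ) R, u z ^ 2 = G z := by
    intro G hG hG0
    obtain ⟨l, hl, -, hle⟩ := log_ball hR hG hG0 (Complex.log (G 0)) (Complex.exp_log (hG0 0 h00))
    refine ⟨fun z => Complex.exp (l z / 2), (hl.div_const 2).cexp, fun z hz => ?_⟩
    rw [← hle z hz, ← Complex.exp_nat_mul]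
    congr 1
    push_cast; ring
  obtain ⟨u, hud, hu2⟩ := sqrt_ex F hFd (fun z hz => by simpa using hFn z hz 0)
  obtain ⟨v, hvd, hv2⟩ := sqrt_ex (fun z => F z - 1) (hFd.sub_const 1)
    (fun z hz => sub_ne_zero.2 (by simpa using hFn z hz 1))
  have huv : ∀ z ∈ ball (0:ℂ) R, (u z - v z) * (u z + v z) = 1 := by
    intro z hz
    linear_combination hu2 z hz - hv2 z hz
  have hne : ∀ z ∈ ball (0:ℂ) R, u z - v z ≠ 0 := fun z hz => left_ne_zero_of_mul_eq_one (huv z hz)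
  obtain ⟨h, hhd, -, hhe⟩ := log_ball hR (hud.sub hvd) hne (Complex.log (u 0 - v 0))
    (Complex.exp_log (hne 0 h00))
  have hhe' : ∀ z ∈ ball (0:ℂ) R, Complex.exp (- h z) = u z + v z := by
    intro z hz
    rw [Complex.exp_neg, hhe z hz]
    exact inv_eq_of_mul_eq_one_right (huv z hz)
  have hcosh : ∀ z ∈ ball (0:ℂ) R, Complex.cosh (h z) ^ 2 = F z := by
    intro z hz
    rw [Complex.cosh, hhe z hz, hhe' z hz, ← hu2 z hz]
    simp only [Pi.sub_apply]
    ring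
  have hbound := landau hR hhd (fun z hz n => by rw [hcosh z hz]; exact hFn z hz n) z hz
  have hzR : z ∈ ball (0:ℂ) R := closedBall_subset_ball (by linarith) hz
  have hu0 : ‖u 0‖ ≤ 2 := by
    have : ‖u 0‖ ^ 2 ≤ 2 := by rw [← norm_pow, hu2 0 h00]; exact hF0
    nlinarith [norm_nonneg (u 0)]
  have hv0 : ‖v 0‖ ≤ 2 := by
    have : ‖v 0‖ ^ 2 ≤ 3 := by
      rw [← norm_pow, hv2 0 h00]
      refine (norm_sub_le _ _).trans ?_
      rw [norm_one]; linarith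
    nlinarith [norm_nonneg (v 0)]
  have he2 : (4:ℝ) ≤ Real.exp 2 := by
    have := Real.add_one_le_exp 1
    have h2 : Real.exp 2 = Real.exp 1 * Real.exp 1 := by rw [← Real.exp_add]; norm_num
    nlinarith
  have hre1 : (h 0).re ≤ 2 := by
    rw [← Real.exp_le_exp, ← Complex.norm_exp, hhe 0 h00]
    have := norm_sub_le (u 0) (v 0)
    simp only [Pi.sub_apply]
    linarith
  have hre2 : -(h 0).re ≤ 2 := by
    rw [← Complex.neg_re, ← Real.exp_le_exp, ← Complex.norm_exp, hhe' 0 h00]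
    have := norm_add_le (u 0) (v 0)
    linarith
  have hre3 := (Complex.abs_re_le_norm (h z - h 0)).trans hbound
  rw [Complex.sub_re, abs_le] at hre3
  have hch : ‖Complex.cosh (h z)‖ ≤ Real.exp 386 := by
    rw [Complex.cosh, norm_div, Complex.norm_two, div_le_iff₀ (by norm_num)]
    refine (norm_add_le _ _).trans ?_
    rw [Complex.norm_exp, Complex.norm_exp, Complex.neg_re, mul_two]
    exact add_le_add (Real.exp_le_exp.2 (by linarith)) (Real.exp_le_exp.2 (by linarith))
  rw [← hLe z hzR]
  refine (Complex.norm_exp_le_exp_norm _).trans (Real.exp_le_exp.2 ?_)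
  have h2 : ‖(2 * Real.pi * Complex.I : ℂ)‖ = 2 * Real.pi := by
    simp [abs_of_pos Real.pi_pos]
  rw [hFL, norm_mul, h2, mul_comm, ← hcosh z hzR, norm_pow]
  gcongr

lemma mero_of_bdd {f : ℂ → ℂ} {r C : ℝ} (hr : 0 < r) (hf : DifferentiableOn ℂ f (ball 0 r \ {0}))
    (hC : ∀ z ∈ ball (0:ℂ) r \ {0}, ‖f z‖ ≤ C) : MeromorphicAt f 0 := by
  have hn : ball (0:ℂ) r ∈ 𝓝 (0:ℂ) := ball_mem_nhds _ hr
  have h := Complex.differentiableOn_update_limUnder_of_bddAbove hn hf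
    ⟨C, by rintro _ ⟨z, hz, rfl⟩; exact hC z hz⟩
  refine (h.analyticAt hn).meromorphicAt.congr ?_
  filter_upwards [self_mem_nhdsWithin] with z hz
  exact Function.update_of_ne hz _ _

lemma circle_bound : ∃ C : ℝ, ∀ (f : ℂ → ℂ) (r : ℝ), 0 < r → DifferentiableOn ℂ f (ball 0 r \ {0}) →
    (∀ z ∈ ball (0:ℂ) r \ {0}, f z ≠ 0 ∧ f z ≠ 1) → ∀ z : ℂ, z ≠ 0 → ‖z‖ < r * Real.exp (-8) →
    1 / 2 ≤ ‖f z‖ → ‖f z‖ ≤ 2 → ∀ w : ℂ, ‖w‖ = ‖z‖ → ‖f w‖ ≤ C := by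
  obtain ⟨C, hC⟩ := schottky
  refine ⟨C, fun f r hr hf hom z hz hzr h1 h2 w hw => ?_⟩
  have hmem : ∀ s ∈ ball (0:ℂ) 8, z * Complex.exp s ∈ ball (0:ℂ) r \ {0} := by
    intro s hs
    rw [mem_ball, dist_zero_right] at hs
    refine ⟨?_, by simp [hz]⟩
    rw [mem_ball, dist_zero_right, norm_mul]
    have h3 : ‖Complex.exp s‖ ≤ Real.exp 8 :=
      (Complex.norm_exp_le_exp_norm _).trans (Real.exp_le_exp.2 hs.le)
    calc ‖z‖ * ‖Complex.exp s‖ ≤ ‖z‖ * Real.exp 8 := by gcongr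
      _ < r * Real.exp (-8) * Real.exp 8 := by gcongr
      _ = r := by rw [mul_assoc, ← Real.exp_add]; simp
  have hg := hC 8 (fun s => f (z * Complex.exp s)) (by norm_num)
    (hf.comp (by fun_prop) hmem) (fun s hs => hom _ (hmem s hs)) (by simpa using h1)
    (by simpa using h2) (Complex.arg (w / z) * Complex.I) (by
      rw [mem_closedBall, dist_zero_right, norm_mul, Complex.norm_I, mul_one, Complex.norm_real]
      have := Complex.abs_arg_le_pi (w / z)
      have := Real.pi_lt_four
      rw [Real.norm_eq_abs]
      linarith)
  have e : z * Complex.exp (Complex.arg (w / z) * Complex.I) = w := by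
    have := Complex.norm_mul_exp_arg_mul_I (w / z)
    rw [norm_div, hw, div_self (norm_ne_zero_iff.2 hz)] at this
    rw [Complex.ofReal_one, one_mul] at this
    rw [this]
    field_simp
  simpa only [e] using hg

lemma picard {f : ℂ → ℂ} {r : ℝ} (hr : 0 < r) (hf : DifferentiableOn ℂ f (ball 0 r \ {0}))
    (hom : ∀ z ∈ ball (0:ℂ) r \ {0}, f z ≠ 0 ∧ f z ≠ 1) : MeromorphicAt f 0 := by
  obtain ⟨C, hC⟩ := circle_bound
  by_cases hcase : ∀ ρ > 0, ∃ z : ℂ, z ≠ 0 ∧ ‖z‖ < ρ ∧ 1 / 2 ≤ ‖f z‖ ∧ ‖f z‖ ≤ 2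
  · have hcirc : ∀ ρ > 0, ∃ t, 0 < t ∧ t < ρ ∧ t < r ∧ ∀ w : ℂ, ‖w‖ = t → ‖f w‖ ≤ C := by
      intro ρ hρ
      obtain ⟨z, hz0, hz1, hz2, hz3⟩ := hcase (min ρ (r * Real.exp (-8))) (by positivity)
      refine ⟨‖z‖, norm_pos_iff.2 hz0, hz1.trans_le (min_le_left _ _), ?_,
        hC f r hr hf hom z hz0 (hz1.trans_le (min_le_right _ _)) hz2 hz3⟩
      refine (hz1.trans_le (min_le_right _ _)).trans_le ?_
      have : Real.exp (-8) ≤ 1 := Real.exp_le_one_iff.2 (by norm_num)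
      nlinarith
    obtain ⟨t, ht0, -, htr, ht⟩ := hcirc r hr
    refine mero_of_bdd (r := t) (C := C) ht0
      (hf.mono (sdiff_subset_sdiff_left (ball_subset_ball htr.le))) ?_
    rintro w ⟨hw1, hw2⟩
    rw [mem_ball, dist_zero_right] at hw1
    obtain ⟨t', ht0', htw, htr', ht'⟩ := hcirc ‖w‖ (norm_pos_iff.2 hw2)
    have hU : {w : ℂ | t' < ‖w‖ ∧ ‖w‖ < t} ⊆ ball 0 t := fun w hw => by simpa using hw.2
    have hcl : closure {w : ℂ | t' < ‖w‖ ∧ ‖w‖ < t} ⊆ {w : ℂ | t' ≤ ‖w‖ ∧ ‖w‖ ≤ t} := by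
      apply closure_minimal (fun w hw => And.intro hw.1.le hw.2.le)
      exact (isClosed_le continuous_const continuous_norm).inter
        (isClosed_le continuous_norm continuous_const)
    have hop : IsOpen {w : ℂ | t' < ‖w‖ ∧ ‖w‖ < t} :=
      (isOpen_lt continuous_const continuous_norm).inter (isOpen_lt continuous_norm continuous_const)
    refine Complex.norm_le_of_forall_mem_frontier_norm_le (U := {w : ℂ | t' < ‖w‖ ∧ ‖w‖ < t})
      (isBounded_ball.subset hU) ?_ ?_ (subset_closure ⟨htw, hw1⟩)
    · apply DifferentiableOn.diffContOnCl
      refine hf.mono (hcl.trans ?_)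
      intro x hx
      refine ⟨by simpa using hx.2.trans_lt htr, ?_⟩
      rintro rfl
      have := hx.1
      simp at this
      linarith
    · intro x hx
      rw [frontier, hop.interior_eq] at hx
      have h1 := hcl hx.1
      by_cases hxt : ‖x‖ = t
      · exact ht x hxt
      · by_cases hxt' : ‖x‖ = t'
        · exact ht' x hxt'
        · exact absurd ⟨lt_of_le_of_ne h1.1 (Ne.symm hxt'), lt_of_le_of_ne h1.2 hxt⟩ hx.2
  · push Not at hcase
    obtain ⟨ρ, hρ, hno⟩ := hcase
    have hsub : ball (0:ℂ) (min ρ r) \ {0} ⊆ ball 0 r \ {0} :=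
      sdiff_subset_sdiff_left (ball_subset_ball (min_le_right _ _))
    have hm : MeromorphicAt (fun z => (f z - 1)⁻¹) 0 := by
      refine mero_of_bdd (r := min ρ r) (C := 2) (by positivity) ?_ ?_
      · exact ((hf.mono hsub).sub_const 1).inv (fun z hz => sub_ne_zero.2 (hom z (hsub hz)).2)
      · intro z hz
        have h1 : ‖z‖ < ρ := by
          have := hz.1
          rw [mem_ball, dist_zero_right] at this
          exact this.trans_le (min_le_left _ _)
        have h2 := hno z hz.2 h1
        rw [norm_inv]
        have h3 : 1 / 2 ≤ ‖f z - 1‖ := by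
          have a1 := norm_sub_norm_le (f z) 1
          have a2 := norm_sub_norm_le 1 (f z)
          rw [norm_sub_rev] at a2
          rw [norm_one] at a1 a2
          by_cases h : 1 / 2 ≤ ‖f z‖
          · have := h2 h
            linarith
          · push Not at h
            linarith
        rw [inv_le_comm₀ (by linarith) (by norm_num)]
        linarith
    have h2 : MeromorphicAt (fun z => ((f z - 1)⁻¹)⁻¹ + 1) 0 :=
      hm.inv.add (MeromorphicAt.const 1 0)
    simpa using h2

lemma local_form {f : ℂ → ℂ} {c : ℂ} (hf : MeromorphicAt f c) (h0 : ∀ᶠ z in 𝓝[≠] c, f z ≠ 0) :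
    ∃ (n : ℤ) (g : ℂ → ℂ), AnalyticAt ℂ g c ∧ g c ≠ 0 ∧
      ∀ᶠ z in 𝓝[≠] c, f z * (z - c) ^ (-n) = g z := by
  obtain ⟨g, hg, hg0, he⟩ := (meromorphicOrderAt_ne_top_iff hf).1
    ((meromorphicOrderAt_ne_top_iff_eventually_ne_zero hf).2 h0)
  refine ⟨(meromorphicOrderAt f c).untop₀, g, hg, hg0, ?_⟩
  filter_upwards [he, self_mem_nhdsWithin] with z hz hzc
  have : z - c ≠ 0 := sub_ne_zero.2 hzc
  rw [hz, smul_eq_mul, zpow_neg]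
  field_simp

lemma mem_D {z : ℂ} : z ∈ ({0, 1} : Set ℂ)ᶜ ↔ z ≠ 0 ∧ z ≠ 1 := by simp

lemma isOpen_D : IsOpen ({0, 1} : Set ℂ)ᶜ := (Set.toFinite _).isClosed.isOpen_compl

lemma conn_D : IsConnected ({0, 1} : Set ℂ)ᶜ :=
  Set.Countable.isConnected_compl_of_one_lt_rank (by simp) (Set.toFinite _).countable

lemma unit_form {f : ℂ → ℂ} (hf : DifferentiableOn ℂ f ({0, 1} : Set ℂ)ᶜ)
    (hm : MapsTo f ({0, 1} : Set ℂ)ᶜ ({0, 1} : Set ℂ)ᶜ) :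
    ∃ (a b : ℤ) (c : ℂ), ∀ z ∈ ({0, 1} : Set ℂ)ᶜ, f z = c * z ^ a * (z - 1) ^ b := by
  have hne : ∀ z ∈ ({0, 1} : Set ℂ)ᶜ, f z ≠ 0 ∧ f z ≠ 1 := fun z hz => mem_D.1 (hm hz)
  have m0 : MeromorphicAt f 0 := by
    have hs : ball (0:ℂ) 1 \ {0} ⊆ ({0, 1} : Set ℂ)ᶜ := by
      rintro z ⟨h1, h2⟩
      refine mem_D.2 ⟨h2, ?_⟩
      rintro rfl
      simp at h1
    exact picard one_pos (hf.mono hs) (fun z hz => hne z (hs hz))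
  have m1 : MeromorphicAt f 1 := by
    have hs : ∀ z ∈ ball (0:ℂ) 1 \ {0}, z + 1 ∈ ({0, 1} : Set ℂ)ᶜ := by
      rintro z ⟨h1, h2⟩
      refine mem_D.2 ⟨?_, by simpa using h2⟩
      intro h
      have : z = -1 := by linear_combination h
      rw [this] at h1
      simp at h1
    have h1 : MeromorphicAt (fun z => f (z + 1)) 0 :=
      picard one_pos (hf.comp (by fun_prop) hs) (fun z hz => hne _ (hs z hz))
    have h2 : AnalyticAt ℂ (fun z : ℂ => z - 1) 1 := by fun_prop
    have h3 := MeromorphicAt.comp_analyticAt (f := fun z => f (z + 1)) (x := 1)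
      (g := fun z : ℂ => z - 1) (by simpa using h1) h2
    simpa [Function.comp_def] using h3
  have mi : MeromorphicAt (fun w => f w⁻¹) 0 := by
    have hs : ∀ z ∈ ball (0:ℂ) 1 \ {0}, z⁻¹ ∈ ({0, 1} : Set ℂ)ᶜ := by
      rintro z ⟨h1, h2⟩
      refine mem_D.2 ⟨by simpa using h2, ?_⟩
      intro h
      rw [inv_eq_one] at h
      rw [h] at h1
      simp at h1
    refine picard one_pos (hf.comp ?_ hs) (fun z hz => hne _ (hs z hz))
    exact differentiableOn_inv.mono (fun z hz => hz.2)
  have ev0 : ∀ᶠ z in 𝓝[≠] (0:ℂ), z ∈ ({0, 1} : Set ℂ)ᶜ := by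
    have : ∀ᶠ z in 𝓝[≠] (0:ℂ), z ≠ 1 :=
      (eventually_ne_nhds zero_ne_one).filter_mono nhdsWithin_le_nhds
    filter_upwards [this, self_mem_nhdsWithin] with z h1 h2
    exact mem_D.2 ⟨h2, h1⟩
  have ev1 : ∀ᶠ z in 𝓝[≠] (1:ℂ), z ∈ ({0, 1} : Set ℂ)ᶜ := by
    have : ∀ᶠ z in 𝓝[≠] (1:ℂ), z ≠ 0 :=
      (eventually_ne_nhds one_ne_zero).filter_mono nhdsWithin_le_nhds
    filter_upwards [this, self_mem_nhdsWithin] with z h1 h2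
    exact mem_D.2 ⟨h1, h2⟩
  obtain ⟨a, g0, hg0, hg00, he0⟩ := local_form m0 (ev0.mono fun z hz => (hne z hz).1)
  obtain ⟨b, g1, hg1, hg10, he1⟩ := local_form m1 (ev1.mono fun z hz => (hne z hz).1)
  obtain ⟨E, hE⟩ : ∃ E : ℂ → ℂ, E = fun z => if z = 0 then g0 0 * (0 - 1) ^ (-b) else
    if z = 1 then g1 1 * 1 ^ (-a) else f z * z ^ (-a) * (z - 1) ^ (-b) := ⟨_, rfl⟩
  have hED : ∀ z ∈ ({0, 1} : Set ℂ)ᶜ, E z = f z * z ^ (-a) * (z - 1) ^ (-b) := by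
    intro z hz
    rw [mem_D] at hz
    rw [hE]; simp [hz.1, hz.2]
  have hE0 : E =ᶠ[𝓝 0] fun z => g0 z * (z - 1) ^ (-b) := by
    have h1 : ∀ᶠ z in 𝓝[≠] (0:ℂ), E z = g0 z * (z - 1) ^ (-b) := by
      filter_upwards [ev0, he0] with z h1 h2
      rw [hED z h1, ← h2, sub_zero]
    rw [eventually_nhdsWithin_iff] at h1
    filter_upwards [h1] with z hz
    by_cases h : z = 0
    · rw [h, hE]; simp
    · exact hz h
  have hE1 : E =ᶠ[𝓝 1] fun z => g1 z * z ^ (-a) := by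
    have h1 : ∀ᶠ z in 𝓝[≠] (1:ℂ), E z = g1 z * z ^ (-a) := by
      filter_upwards [ev1, he1] with z h1 h2
      rw [hED z h1, ← h2]; ring
    rw [eventually_nhdsWithin_iff] at h1
    filter_upwards [h1] with z hz
    by_cases h : z = 1
    · rw [h, hE]; simp
    · exact hz h
  have hEne : ∀ z, E z ≠ 0 := by
    intro z
    by_cases h0 : z = 0
    · rw [h0, hE0.eq_of_nhds]
      exact mul_ne_zero hg00 (zpow_ne_zero _ (by norm_num))
    by_cases h1 : z = 1
    · rw [h1, hE1.eq_of_nhds]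
      exact mul_ne_zero hg10 (zpow_ne_zero _ (by norm_num))
    have hz := mem_D.2 ⟨h0, h1⟩
    rw [hED z hz]
    exact mul_ne_zero (mul_ne_zero (hne z hz).1 (zpow_ne_zero _ h0))
      (zpow_ne_zero _ (sub_ne_zero.2 h1))
  have hEd : Differentiable ℂ E := by
    intro z
    by_cases h0 : z = 0
    · rw [h0]
      refine DifferentiableAt.congr_of_eventuallyEq ?_ hE0
      exact hg0.differentiableAt.mul
        (((differentiableAt_id).sub_const 1).zpow (Or.inl (by norm_num)))
    by_cases h1 : z = 1
    · rw [h1]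
      refine DifferentiableAt.congr_of_eventuallyEq ?_ hE1
      exact hg1.differentiableAt.mul (differentiableAt_id.zpow (Or.inl (by norm_num)))
    have hz := mem_D.2 ⟨h0, h1⟩
    have hev : E =ᶠ[𝓝 z] fun z => f z * z ^ (-a) * (z - 1) ^ (-b) := by
      filter_upwards [isOpen_D.mem_nhds hz] with w hw using hED w hw
    refine DifferentiableAt.congr_of_eventuallyEq ?_ hev
    exact ((hf.differentiableAt (isOpen_D.mem_nhds hz)).mul
      (differentiableAt_id.zpow (Or.inl h0))).mul
        (((differentiableAt_id).sub_const 1).zpow (Or.inl (sub_ne_zero.2 h1)))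
  have mE : MeromorphicAt (fun w => E w⁻¹) 0 := by
    have hid : MeromorphicAt (fun w : ℂ => w⁻¹) 0 := (MeromorphicAt.id 0).inv
    have h1 : MeromorphicAt (fun w => f w⁻¹ * w⁻¹ ^ (-a) * (w⁻¹ - 1) ^ (-b)) 0 :=
      (mi.mul (hid.zpow _)).mul ((hid.sub (MeromorphicAt.const 1 0)).zpow _)
    refine h1.congr ?_
    filter_upwards [ev0] with w hw
    rw [mem_D] at hw
    rw [hED]
    exact mem_D.2 ⟨inv_ne_zero hw.1, by simpa using hw.2⟩
  have tinv : Tendsto (fun z : ℂ => z⁻¹) (cocompact ℂ) (𝓝[≠] 0) := by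
    rw [← Metric.cobounded_eq_cocompact]
    exact tendsto_inv₀_cobounded'
  have hconst : ∃ c, ∀ z, E z = c := by
    rcases lt_or_ge (meromorphicOrderAt (fun w => E w⁻¹) 0) 0 with h | h
    · exfalso
      have h1 := tendsto_cobounded_of_meromorphicOrderAt_neg h
      have h2 := (tendsto_inv₀_cobounded.comp h1).comp tinv
      have h3 : Differentiable ℂ (fun z => (E z)⁻¹) := hEd.inv hEne
      have h4 := h3.apply_eq_of_tendsto_cocompact 0 (c := 0)
        (h2.congr (fun z => by simp))
      exact inv_ne_zero (hEne 0) h4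
    · obtain ⟨c, hc⟩ := tendsto_nhds_of_meromorphicOrderAt_nonneg mE h
      exact ⟨c, fun z => hEd.apply_eq_of_tendsto_cocompact z
        ((hc.comp tinv).congr (fun z => by simp))⟩
  obtain ⟨c, hc⟩ := hconst
  refine ⟨a, b, c, fun z hz => ?_⟩
  rw [← hc z, hED z hz]
  rw [mem_D] at hz
  have h1 := sub_ne_zero.2 hz.2
  have h0 := hz.1
  rw [zpow_neg, zpow_neg]
  field_simp

lemma ratio_const {φ : ℂ × ℂ → ℂ}
    (hφ : DifferentiableOn ℂ φ (({0, 1} : Set ℂ)ᶜ ×ˢ ({0, 1} : Set ℂ)ᶜ))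
    (hm : MapsTo φ (({0, 1} : Set ℂ)ᶜ ×ˢ ({0, 1} : Set ℂ)ᶜ) ({0, 1} : Set ℂ)ᶜ)
    {p z : ℂ} (hp : p ∈ ({0, 1} : Set ℂ)ᶜ) (hz : z ∈ ({0, 1} : Set ℂ)ᶜ) :
    ∃ A : ℂ, ∀ w ∈ ({0, 1} : Set ℂ)ᶜ, φ (z, w) = A * φ (p, w) := by
  have hc : ∀ x ∈ ({0, 1} : Set ℂ)ᶜ, ContinuousOn (fun w => φ (x, w)) ({0, 1} : Set ℂ)ᶜ := by
    intro x hx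
    exact hφ.continuousOn.comp (by fun_prop) (fun w hw => ⟨hx, hw⟩)
  have hne : ∀ w ∈ ({0, 1} : Set ℂ)ᶜ, φ (p, w) ≠ 0 := fun w hw => (mem_D.1 (hm ⟨hp, hw⟩)).1
  have hq : ContinuousOn (fun w => φ (z, w) / φ (p, w)) ({0, 1} : Set ℂ)ᶜ :=
    (hc z hz).div (hc p hp) hne
  have hcount : ((fun w => φ (z, w) / φ (p, w)) '' ({0, 1} : Set ℂ)ᶜ).Countable := by
    refine (Set.countable_range (fun q : ℤ × ℤ => (z / p) ^ q.1 * ((z - 1) / (p - 1)) ^ q.2)).mono ?_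
    rintro _ ⟨w, hw, rfl⟩
    obtain ⟨a, b, c, h⟩ := unit_form (f := fun x => φ (x, w))
      (hφ.comp (by fun_prop) (fun x hx => ⟨hx, hw⟩)) (fun x hx => hm ⟨hx, hw⟩)
    refine ⟨(a, b), ?_⟩
    have h1 := h z hz
    have h2 := h p hp
    have h3 := hne w hw
    simp only at h1 h2 ⊢
    rw [h2] at h3
    rw [h1, h2, div_zpow, div_zpow]
    have := mul_ne_zero_iff.1 h3
    have h4 := mul_ne_zero_iff.1 this.1
    have h5 := h4.1
    have h6 := h4.2
    have h7 := this.2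
    field_simp
  have hsub := hcount.isTotallyDisconnected _ subset_rfl (conn_D.isPreconnected.image _ hq)
  obtain ⟨w0, hw0⟩ := conn_D.nonempty
  refine ⟨φ (z, w0) / φ (p, w0), fun w hw => ?_⟩
  have := hsub ⟨w, hw, rfl⟩ ⟨w0, hw0, rfl⟩
  simp only at this
  rw [← this]
  have := hne w hw
  field_simp

lemma dep_one {φ : ℂ × ℂ → ℂ}
    (hφ : DifferentiableOn ℂ φ (({0, 1} : Set ℂ)ᶜ ×ˢ ({0, 1} : Set ℂ)ᶜ))
    (hm : MapsTo φ (({0, 1} : Set ℂ)ᶜ ×ˢ ({0, 1} : Set ℂ)ᶜ) ({0, 1} : Set ℂ)ᶜ)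
    {p : ℂ} (hp : p ∈ ({0, 1} : Set ℂ)ᶜ) :
    (∀ z ∈ ({0, 1} : Set ℂ)ᶜ, ∀ w ∈ ({0, 1} : Set ℂ)ᶜ, φ (z, w) = φ (p, w)) ∨
    (∀ z ∈ ({0, 1} : Set ℂ)ᶜ, ∀ w ∈ ({0, 1} : Set ℂ)ᶜ, φ (z, w) = φ (z, p)) := by
  have hA := fun z hz => ratio_const hφ hm hp (z := z) hz
  have hB := fun z hz => ratio_const (φ := fun x => 1 - φ x) (by exact hφ.const_sub 1)
    (fun x hx => by
      have := mem_D.1 (hm hx)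
      refine mem_D.2 ⟨sub_ne_zero.2 this.2.symm, ?_⟩
      intro h
      exact this.1 (by linear_combination -h)) hp (z := z) hz
  by_cases hall : ∀ z ∈ ({0, 1} : Set ℂ)ᶜ, ∀ w ∈ ({0, 1} : Set ℂ)ᶜ, φ (z, w) = φ (p, w)
  · exact Or.inl hall
  right
  push Not at hall
  obtain ⟨z, hz, w, hw, hne⟩ := hall
  obtain ⟨A, hA1⟩ := hA z hz
  obtain ⟨B, hB1⟩ := hB z hz
  have hAB : A - B ≠ 0 := by
    intro h
    have hAB : A = B := by linear_combination h
    have h1 := hA1 w hw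
    have h2 := hB1 w hw
    simp only [← hAB] at h2
    have h3 : A = 1 := by linear_combination -h1 - h2
    rw [h3, one_mul] at h1
    exact hne h1
  have hx : ∀ w ∈ ({0, 1} : Set ℂ)ᶜ, φ (p, w) = (1 - B) / (A - B) := by
    intro w hw
    have h1 := hA1 w hw
    have h2 := hB1 w hw
    field_simp
    linear_combination -h1 - h2
  intro z' hz' w' hw'
  obtain ⟨A', hA'⟩ := hA z' hz'
  rw [hA' w' hw', hA' p hp, hx w' hw', hx p hp]

lemma not_compact_D : ¬ IsCompact ({0, 1} : Set ℂ)ᶜ := by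
  intro h
  have h1 : IsClopen ({0, 1} : Set ℂ)ᶜ := ⟨h.isClosed, isOpen_D⟩
  have h2 := h1.eq_univ conn_D.nonempty
  have : (0:ℂ) ∈ ({0, 1} : Set ℂ)ᶜ := by rw [h2]; trivial
  simp at this

end Helpers

/-- **The paper's motivating example.** For `D = ℂ ∖ {0,1}`, every proper holomorphic map
`f = (f₁, f₂) : D × D → D × D` splits, possibly after a swap of the variables. -/
theorem motivating_example (F : ℂ × ℂ → ℂ × ℂ)
    (hF : DifferentiableOn ℂ F (({0, 1} : Set ℂ)ᶜ ×ˢ ({0, 1} : Set ℂ)ᶜ))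
    (hmaps : MapsTo F (({0, 1} : Set ℂ)ᶜ ×ˢ ({0, 1} : Set ℂ)ᶜ)
      (({0, 1} : Set ℂ)ᶜ ×ˢ ({0, 1} : Set ℂ)ᶜ))
    (hproper : ∀ K, K ⊆ (({0, 1} : Set ℂ)ᶜ ×ˢ ({0, 1} : Set ℂ)ᶜ) → IsCompact K →
      IsCompact ((({0, 1} : Set ℂ)ᶜ ×ˢ ({0, 1} : Set ℂ)ᶜ) ∩ F ⁻¹' K)) :
    ∃ g₁ g₂ : ℂ → ℂ,
      DifferentiableOn ℂ g₁ ({0, 1} : Set ℂ)ᶜ ∧ DifferentiableOn ℂ g₂ ({0, 1} : Set ℂ)ᶜ ∧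
      MapsTo g₁ ({0, 1} : Set ℂ)ᶜ ({0, 1} : Set ℂ)ᶜ ∧
      MapsTo g₂ ({0, 1} : Set ℂ)ᶜ ({0, 1} : Set ℂ)ᶜ ∧
      ((∀ z ∈ (({0, 1} : Set ℂ)ᶜ ×ˢ ({0, 1} : Set ℂ)ᶜ), F z = (g₁ z.1, g₂ z.2)) ∨
       (∀ z ∈ (({0, 1} : Set ℂ)ᶜ ×ˢ ({0, 1} : Set ℂ)ᶜ), F z = (g₁ z.2, g₂ z.1))) := by
  obtain ⟨p, hp⟩ := conn_D.nonempty
  have d1 : DifferentiableOn ℂ (fun x => (F x).1) (({0, 1} : Set ℂ)ᶜ ×ˢ ({0, 1} : Set ℂ)ᶜ) := hF.fst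
  have d2 : DifferentiableOn ℂ (fun x => (F x).2) (({0, 1} : Set ℂ)ᶜ ×ˢ ({0, 1} : Set ℂ)ᶜ) := hF.snd
  have m1 : MapsTo (fun x => (F x).1) (({0, 1} : Set ℂ)ᶜ ×ˢ ({0, 1} : Set ℂ)ᶜ) ({0, 1} : Set ℂ)ᶜ :=
    fun x hx => (hmaps hx).1
  have m2 : MapsTo (fun x => (F x).2) (({0, 1} : Set ℂ)ᶜ ×ˢ ({0, 1} : Set ℂ)ᶜ) ({0, 1} : Set ℂ)ᶜ :=
    fun x hx => (hmaps hx).2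
  have L : MapsTo (fun x : ℂ => (x, p)) ({0, 1} : Set ℂ)ᶜ
    (({0, 1} : Set ℂ)ᶜ ×ˢ ({0, 1} : Set ℂ)ᶜ) := fun x hx => ⟨hx, hp⟩
  have R : MapsTo (fun x : ℂ => (p, x)) ({0, 1} : Set ℂ)ᶜ
    (({0, 1} : Set ℂ)ᶜ ×ˢ ({0, 1} : Set ℂ)ᶜ) := fun x hx => ⟨hp, hx⟩
  have hL : DifferentiableOn ℂ (fun x : ℂ => (x, p)) ({0, 1} : Set ℂ)ᶜ := by fun_prop
  have hR : DifferentiableOn ℂ (fun x : ℂ => (p, x)) ({0, 1} : Set ℂ)ᶜ := by fun_prop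
  have hcomp := hproper {F (p, p)} (by simpa using hmaps (L hp)) isCompact_singleton
  rcases dep_one d1 m1 hp with h1 | h1 <;> rcases dep_one d2 m2 hp with h2 | h2
  · exfalso
    have h3 : Prod.fst '' ((({0, 1} : Set ℂ)ᶜ ×ˢ ({0, 1} : Set ℂ)ᶜ) ∩ F ⁻¹' {F (p, p)}) =
        ({0, 1} : Set ℂ)ᶜ := by
      ext x
      constructor
      · rintro ⟨y, hy, rfl⟩
        exact hy.1.1
      · intro hx
        exact ⟨(x, p), ⟨L hx, Prod.ext (h1 x hx p hp) (h2 x hx p hp)⟩, rfl⟩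
    have h4 := hcomp.image continuous_fst
    rw [h3] at h4
    exact not_compact_D h4
  · exact ⟨fun w => (F (p, w)).1, fun z => (F (z, p)).2, d1.comp hR R, d2.comp hL L, m1.comp R,
      m2.comp L, Or.inr fun z hz => Prod.ext (h1 _ hz.1 _ hz.2) (h2 _ hz.1 _ hz.2)⟩
  · exact ⟨fun z => (F (z, p)).1, fun w => (F (p, w)).2, d1.comp hL L, d2.comp hR R, m1.comp L,
      m2.comp R, Or.inl fun z hz => Prod.ext (h1 _ hz.1 _ hz.2) (h2 _ hz.1 _ hz.2)⟩
  · exfalso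
    have h3 : Prod.snd '' ((({0, 1} : Set ℂ)ᶜ ×ˢ ({0, 1} : Set ℂ)ᶜ) ∩ F ⁻¹' {F (p, p)}) =
        ({0, 1} : Set ℂ)ᶜ := by
      ext x
      constructor
      · rintro ⟨y, hy, rfl⟩
        exact hy.1.2
      · intro hx
        exact ⟨(p, x), ⟨R hx, Prod.ext (h1 p hp x hx) (h2 p hp x hx)⟩, rfl⟩
    have h4 := hcomp.image continuous_snd
    rw [h3] at h4
    exact not_compact_D h4
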